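/- Let q ∈ (0,1), let a ∈ ℝ be nonzero, let φ ∈ ℝ, and let n ∈ ℤ≥0. Then for all x ∈ ℂ: (1−a e^{ix})(1−a e^{−ix})(1−a e^{i(x+2φ)})(1−a e^{−i(x+2φ)}) · p_n(cos(x+φ); qa | q) = a²(1−q^{n+1})(1−q^{n+2}) · p_{n+2}(cos(x+φ); a|q) − 2a cos φ · (1−q^{n+1})(1−a²q^{n+1}) · p_{n+1}(cos(x+φ); a|q) + (1−a²q^{n})(1−a²q^{n+1}) · p_n(cos(x+φ); a|q). -/

import Mathlib

open Complex Finset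

/-- q-Pochhammer symbol `(a;q)_k = ∏_{j=0}^{k-1} (1 - a q^j)`. -/
noncomputable def qPoch (q a : ℂ) (k : ℕ) : ℂ := ∏ j ∈ Finset.range k, (1 - a * q ^ j)

/-- q-Meixner–Pollaczek polynomial `p_n(cos(x+φ); a | q)` as a function of `x ∈ ℂ`. -/
noncomputable def qMPPoly (q a : ℂ) (φ : ℝ) (n : ℕ) (x : ℂ) : ℂ :=
  a ^ (-(n : ℤ)) * Complex.exp (-(n * Complex.I * φ)) / qPoch q q n *
    ∑ k ∈ Finset.range (n + 1),
      qPoch q (q ^ (-(n : ℤ))) k * qPoch q (a * Complex.exp (Complex.I * (x + 2 * φ))) k *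
        qPoch q (a * Complex.exp (-(Complex.I * x))) k * q ^ k / qPoch q q k *
        qPoch q (a ^ 2 * q ^ k) (n - k)

/-- The coefficient `(q^{-n};q)_k q^k / (q;q)_k`. -/
noncomputable def cc (q : ℂ) (n k : ℕ) : ℂ :=
  qPoch q (q ^ (-(n : ℤ))) k * q ^ k / qPoch q q k

lemma qPoch_zero (q a : ℂ) : qPoch q a 0 = 1 := by simp [qPoch]

lemma qPoch_succ (q a : ℂ) (k : ℕ) : qPoch q a (k+1) = qPoch q a k * (1 - a * q ^ k) := by
  simp [qPoch, Finset.prod_range_succ]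

lemma qPoch_succ' (q a : ℂ) (k : ℕ) : qPoch q a (k+1) = (1 - a) * qPoch q (a * q) k := by
  simp only [qPoch, Finset.prod_range_succ']
  rw [mul_comm]
  congr 1
  · simp
  · apply Finset.prod_congr rfl
    intros; ring

lemma qPoch_qq_ne (q : ℂ) (hq : ∀ k : ℕ, q ^ (k+1) ≠ 1) (k : ℕ) : qPoch q q k ≠ 0 := by
  rw [qPoch, Finset.prod_ne_zero_iff]
  intro j _ h
  apply hq j
  rw [pow_succ]
  linear_combination -h

lemma cc_zero (q : ℂ) (n : ℕ) : cc q n 0 = 1 := by simp [cc, qPoch_zero]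

lemma cc_eq_zero (q : ℂ) (hq0 : q ≠ 0) (n k : ℕ) (h : n < k) : cc q n k = 0 := by
  have : qPoch q (q ^ (-(n : ℤ))) k = 0 := by
    rw [qPoch, Finset.prod_eq_zero_iff]
    refine ⟨n, Finset.mem_range.2 h, ?_⟩
    rw [zpow_neg, zpow_natCast, inv_mul_cancel₀ (pow_ne_zero _ hq0), sub_self]
  rw [cc, this, zero_mul, zero_div]

lemma cc_succ (q : ℂ) (n k : ℕ) :
    cc q n (k+1) = cc q n k * ((1 - (q ^ n)⁻¹ * q ^ k) * q / (1 - q * q ^ k)) := by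
  simp only [cc, qPoch_succ, zpow_neg, zpow_natCast, pow_succ]
  rw [div_mul_div_comm]
  congr 1
  ring

lemma cc_up (q : ℂ) (hq0 : q ≠ 0) (hq : ∀ k : ℕ, q ^ (k+1) ≠ 1) (n k : ℕ) :
    cc q (n+1) (k+1) = cc q n k * ((1 - (q ^ (n+1))⁻¹) * q / (1 - q * q ^ k)) := by
  simp only [cc, qPoch_succ q q]
  rw [qPoch_succ']
  have : q ^ (-((n+1 : ℕ) : ℤ)) * q = q ^ (-(n : ℤ)) := by
    simp only [zpow_neg, zpow_natCast, pow_succ]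
    field_simp
  rw [this, div_mul_div_comm]
  simp only [zpow_neg, zpow_natCast]
  congr 1
  ring

lemma den_ne (q : ℂ) (hq : ∀ k : ℕ, q ^ (k+1) ≠ 1) (k : ℕ) : 1 - q * q ^ k ≠ 0 := by
  intro h
  apply hq k
  rw [pow_succ]
  linear_combination -h

lemma pascal1 (q : ℂ) (hq0 : q ≠ 0) (hq : ∀ k : ℕ, q ^ (k+1) ≠ 1) (n k : ℕ) :
    cc q n (k+1) - cc q (n+1) (k+1) = (q ^ n)⁻¹ * cc q n k := by
  rw [cc_succ, cc_up q hq0 hq]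
  have h1 := den_ne q hq k
  have h2 := pow_ne_zero n hq0
  rw [pow_succ]
  generalize cc q n k = c at *
  generalize q ^ k = v at *
  generalize q ^ n = w at *
  have : (1 - w⁻¹ * v) * q / (1 - q * v) - (1 - (w * q)⁻¹) * q / (1 - q * v) = w⁻¹ := by
    rw [← sub_div, div_eq_iff h1]
    field_simp
    ring
  linear_combination c * this

lemma pascal2 (q : ℂ) (hq0 : q ≠ 0) (hq : ∀ k : ℕ, q ^ (k+1) ≠ 1) (n k : ℕ) :
    cc q (n+1) (k+1) = (q ^ (k+1))⁻¹ * cc q n (k+1) - (q ^ k)⁻¹ * cc q n k := by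
  rw [cc_up q hq0 hq, cc_succ]
  have h1 := den_ne q hq k
  have h2 := pow_ne_zero n hq0
  have h3 := pow_ne_zero k hq0
  rw [pow_succ, pow_succ]
  generalize cc q n k = c at *
  generalize q ^ k = v at *
  generalize q ^ n = w at *
  field_simp
  ring

/-- The inner sum. -/
noncomputable def SS (q A B s : ℂ) (n : ℕ) : ℂ :=
  ∑ k ∈ Finset.range (n+1), cc q n k * (qPoch q A k * qPoch q B k) * qPoch q (s * q ^ k) (n - k)

lemma key (q : ℂ) (hq0 : q ≠ 0) (hq : ∀ k : ℕ, q ^ (k+1) ≠ 1) (A B s E : ℂ)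
    (hs : A * B * E = s) (n : ℕ) :
    (q ^ n)⁻¹ * ((1 - A) * (1 - B) * (1 - A * E) * (1 - B * E)) *
      SS q (A * q) (B * q) (s * q ^ 2) n
    = E * SS q A B s (n+2) - (1 + E) * (1 - s * q ^ (n+1)) * SS q A B s (n+1)
      + (1 - s * q ^ n) * (1 - s * q ^ (n+1)) * SS q A B s n := by
  set R : ℕ → ℂ := fun j => qPoch q (s * q ^ j) (n + 2 - j) with hR
  set u : ℕ → ℂ := fun j => qPoch q A j * qPoch q B j with hu
  have e1 : (1 - s * q ^ (n+1)) * SS q A B s (n+1)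
      = ∑ j ∈ Finset.range (n+3), cc q (n+1) j * u j * R j := by
    rw [Finset.sum_range_succ, cc_eq_zero q hq0 (n+1) (n+2) (by omega), SS, Finset.mul_sum]
    simp only [zero_mul, add_zero]
    apply Finset.sum_congr rfl
    intro j hj
    obtain ⟨r, hr⟩ := Nat.exists_eq_add_of_le (Nat.lt_succ_iff.1 (Finset.mem_range.1 hj))
    have h1 : n + 1 - j = r := by omega
    have h2 : n + 2 - j = r + 1 := by omega
    simp only [hR, hu, h1, h2, qPoch_succ q (s * q ^ j)]
    rw [hr, pow_add]
    ring
  have e0 : (1 - s * q ^ n) * (1 - s * q ^ (n+1)) * SS q A B s n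
      = ∑ j ∈ Finset.range (n+3), cc q n j * u j * R j := by
    rw [Finset.sum_range_succ, Finset.sum_range_succ, cc_eq_zero q hq0 n (n+2) (by omega),
      cc_eq_zero q hq0 n (n+1) (by omega), SS, Finset.mul_sum]
    simp only [zero_mul, add_zero]
    apply Finset.sum_congr rfl
    intro j hj
    obtain ⟨r, hr⟩ := Nat.exists_eq_add_of_le (Nat.lt_succ_iff.1 (Finset.mem_range.1 hj))
    have h1 : n - j = r := by omega
    have h2 : n + 2 - j = r + 1 + 1 := by omega
    simp only [hR, hu, h1, h2, qPoch_succ q (s * q ^ j)]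
    rw [hr]
    ring
  have e2 : SS q A B s (n+2) = ∑ j ∈ Finset.range (n+3), cc q (n+2) j * u j * R j := rfl
  have hb0 : E * cc q (n+2) 0 - (1 + E) * cc q (n+1) 0 + cc q n 0 = 0 := by
    simp only [cc_zero]; ring
  set e : ℕ → ℂ := fun k => Nat.casesOn k 0 (fun k => cc q n k * (q ^ (k+1))⁻¹ * E) with he
  have hb : ∀ k, E * cc q (n+2) (k+1) - (1 + E) * cc q (n+1) (k+1) + cc q n (k+1)
      = (q ^ n)⁻¹ * (cc q n k * (1 - (q ^ (k+1))⁻¹ * E) + e k) := by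
    intro k
    have p1 := pascal1 q hq0 hq n k
    have p2 := pascal1 q hq0 hq (n+1) k
    have h2 := pow_ne_zero n hq0
    have h3 : (q ^ (n+1))⁻¹ * cc q (n+1) k
        = (q ^ n)⁻¹ * (cc q n k * (q ^ (k+1))⁻¹ ) - (q ^ n)⁻¹ *
          (Nat.casesOn k 0 (fun k => cc q n k * (q ^ (k+1))⁻¹) : ℂ) := by
      cases k with
      | zero => simp [cc_zero, pow_succ, mul_comm]
      | succ k =>
        rw [pascal2 q hq0 hq]
        have h3 := pow_ne_zero k hq0
        simp only [pow_succ]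
        field_simp
    have h4 : e k = (Nat.casesOn k 0 (fun k => cc q n k * (q ^ (k+1))⁻¹) : ℂ) * E := by
      cases k <;> simp [he]
    rw [h4]
    linear_combination p1 - E * p2 - E * h3
  have rhs : E * SS q A B s (n+2) - (1 + E) * (1 - s * q ^ (n+1)) * SS q A B s (n+1)
      + (1 - s * q ^ n) * (1 - s * q ^ (n+1)) * SS q A B s n
      = ∑ j ∈ Finset.range (n+3),
        (E * cc q (n+2) j - (1 + E) * cc q (n+1) j + cc q n j) * (u j * R j) := by
    rw [mul_assoc (1+E), e0, e1, e2, Finset.mul_sum, Finset.mul_sum, ← Finset.sum_sub_distrib,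
      ← Finset.sum_add_distrib]
    apply Finset.sum_congr rfl
    intros; ring
  rw [rhs, Finset.sum_range_succ', hb0, zero_mul, add_zero]
  simp only [hb]
  simp only [mul_add, add_mul, Finset.sum_add_distrib]
  rw [Finset.sum_range_succ, cc_eq_zero q hq0 n (n+1) (by omega),
    Finset.sum_range_succ' (fun k => (q ^ n)⁻¹ * e k * (u (k+1) * R (k+1)))]
  have he0 : e 0 = 0 := rfl
  rw [he0]
  simp only [he, mul_zero, zero_mul, add_zero]
  rw [SS, Finset.mul_sum, ← Finset.sum_add_distrib]
  apply Finset.sum_congr rfl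
  intro k hk
  obtain ⟨r, hr⟩ := Nat.exists_eq_add_of_le (Nat.lt_succ_iff.1 (Finset.mem_range.1 hk))
  have h1 : n - k = r := by omega
  have h2 : n + 2 - (k+1) = r + 1 := by omega
  have h3 : n + 2 - (k+1+1) = r := by omega
  have hu2 : u (k+1+1) = u (k+1) * ((1 - A * q ^ (k+1)) * (1 - B * q ^ (k+1))) := by
    simp only [hu, qPoch_succ _ _ (k+1)]; ring
  have hu1 : u (k+1) = (1-A) * (1-B) * (qPoch q (A*q) k * qPoch q (B*q) k) := by
    simp only [hu, qPoch_succ']; ring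
  have hR1 : R (k+1) = (1 - s * q ^ (k+1)) * R (k+1+1) := by
    simp only [hR, h2, h3, qPoch_succ', pow_succ q (k+1), mul_assoc]
  have hR2 : qPoch q (s * q ^ 2 * q ^ k) (n - k) = R (k+1+1) := by
    simp only [hR, h1, h3]; congr 1; ring
  rw [hR2, hu2, hu1, hR1, ← hs]
  have h4 := pow_ne_zero (k+1) hq0
  have h5 : (q ^ (k+1))⁻¹ * q ^ (k+1) = 1 := inv_mul_cancel₀ h4
  linear_combination (-((q ^ n)⁻¹ * cc q n k * ((1-A) * (1-B) *
    (qPoch q (A*q) k * qPoch q (B*q) k)) * R (k+1+1) *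
    (A*B*E^2 - E*(A+B) + q^(k+1)*E*A*B))) * h5

lemma qMP_eq (q a : ℂ) (φ : ℝ) (n : ℕ) (x : ℂ) :
    qMPPoly q a φ n x = (a ^ n)⁻¹ * (exp (I * φ) ^ n)⁻¹ / qPoch q q n *
      SS q (a * exp (I * (x + 2 * φ))) (a * exp (-(I * x))) (a ^ 2) n := by
  rw [qMPPoly, SS, zpow_neg, zpow_natCast, ← Complex.exp_nat_mul, ← Complex.exp_neg, ← mul_assoc]
  congr 1
  apply Finset.sum_congr rfl
  intros
  simp only [cc]
  ring

/-- The Christoffel relation (Theorem `thm:PhiPn` of the paper) for the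
q-Meixner–Pollaczek polynomials. -/
theorem q_meixner_pollaczek_christoffel
    (q : ℝ) (hq0 : 0 < q) (hq1 : q < 1)
    (a : ℝ) (ha : a ≠ 0) (φ : ℝ) (n : ℕ) (x : ℂ) :
    (1 - (a : ℂ) * Complex.exp (Complex.I * x)) *
      (1 - (a : ℂ) * Complex.exp (-(Complex.I * x))) *
      (1 - (a : ℂ) * Complex.exp (Complex.I * (x + 2 * φ))) *
      (1 - (a : ℂ) * Complex.exp (-(Complex.I * (x + 2 * φ)))) *
      qMPPoly (q : ℂ) ((q : ℂ) * a) φ n x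
    = (a : ℂ) ^ 2 * (1 - (q : ℂ) ^ (n + 1)) * (1 - (q : ℂ) ^ (n + 2)) *
        qMPPoly (q : ℂ) (a : ℂ) φ (n + 2) x
      - 2 * (a : ℂ) * (Real.cos φ : ℂ) * (1 - (q : ℂ) ^ (n + 1)) *
          (1 - (a : ℂ) ^ 2 * (q : ℂ) ^ (n + 1)) * qMPPoly (q : ℂ) (a : ℂ) φ (n + 1) x
      + (1 - (a : ℂ) ^ 2 * (q : ℂ) ^ n) * (1 - (a : ℂ) ^ 2 * (q : ℂ) ^ (n + 1)) *
          qMPPoly (q : ℂ) (a : ℂ) φ n x := by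
  have hq0' : (q : ℂ) ≠ 0 := by exact_mod_cast hq0.ne'
  have ha' : (a : ℂ) ≠ 0 := by exact_mod_cast ha
  have hq : ∀ k : ℕ, (q : ℂ) ^ (k+1) ≠ 1 := by
    intro k h
    have h' : q ^ (k+1) = 1 := by exact_mod_cast h
    exact (pow_lt_one₀ hq0.le hq1 (Nat.succ_ne_zero k)).ne h'
  simp only [qMP_eq, qPoch_succ (q : ℂ) (q : ℂ)]
  have hp := qPoch_qq_ne (q : ℂ) hq n
  have d1 := den_ne (q : ℂ) hq n
  have d2 := den_ne (q : ℂ) hq (n+1)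
  have he : exp (I * (φ : ℂ)) ≠ 0 := exp_ne_zero _
  have hx : exp (I * x) ≠ 0 := exp_ne_zero _
  have hcos : 2 * (Real.cos φ : ℂ) = exp (I * φ) + (exp (I * φ))⁻¹ := by
    rw [Complex.ofReal_cos, Complex.cos, ← Complex.exp_neg, mul_comm I (φ : ℂ), neg_mul]
    ring
  have hA : exp (I * (x + 2 * φ)) = exp (I * x) * exp (I * φ) ^ 2 := by
    rw [← Complex.exp_nat_mul, ← Complex.exp_add]; congr 1; push_cast; ring
  have hcos' : 2 * (a : ℂ) * (Real.cos φ : ℂ) = a * (exp (I * φ) + (exp (I * φ))⁻¹) := by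
    rw [← hcos]; ring
  rw [hcos']
  simp only [Complex.exp_neg, hA]
  generalize exp (I * (φ : ℂ)) = e at *
  generalize exp (I * x) = z at *
  have K := key (q : ℂ) hq0' hq (a * (z * e ^ 2)) (a * z⁻¹) (a ^ 2) ((e ^ 2)⁻¹)
    (by field_simp) n
  have r1 : (q : ℂ) * a * (z * e ^ 2) = a * (z * e ^ 2) * q := by ring
  have r2 : (q : ℂ) * a * z⁻¹ = a * z⁻¹ * q := by ring
  have r3 : ((q : ℂ) * a) ^ 2 = a ^ 2 * q ^ 2 := by ring
  rw [r1, r2, r3]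
  generalize SS (q : ℂ) (a * (z * e ^ 2) * q) (a * z⁻¹ * q) (a ^ 2 * q ^ 2) n = T at *
  generalize SS (q : ℂ) (a * (z * e ^ 2)) (a * z⁻¹) (a ^ 2) n = S0 at *
  generalize SS (q : ℂ) (a * (z * e ^ 2)) (a * z⁻¹) (a ^ 2) (n+1) = S1 at *
  generalize SS (q : ℂ) (a * (z * e ^ 2)) (a * z⁻¹) (a ^ 2) (n+2) = S2 at *
  generalize qPoch (q : ℂ) q n = P at *
  have f1 : (1 : ℂ) - q ^ (n+1) = 1 - q * q ^ n := by ring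
  have f2 : (1 : ℂ) - q ^ (n+2) = 1 - q * q ^ (n+1) := by ring
  rw [f1, f2]
  generalize (1 : ℂ) - q * q ^ n = D1 at *
  generalize (1 : ℂ) - q * q ^ (n+1) = D2 at *
  have g2 : (a : ℂ) ^ 2 * D1 * D2 * (((a : ℂ) ^ (n+2))⁻¹ * (e ^ (n+2))⁻¹ / (P * D1 * D2) * S2)
      = ((a : ℂ) ^ n)⁻¹ * (e ^ n)⁻¹ / P * ((e ^ 2)⁻¹ * S2) := by
    rw [pow_add, pow_add]; field_simp
  have g1 : ∀ y : ℂ, (a : ℂ) * (e + e⁻¹) * D1 * y *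
      (((a : ℂ) ^ (n+1))⁻¹ * (e ^ (n+1))⁻¹ / (P * D1) * S1)
      = ((a : ℂ) ^ n)⁻¹ * (e ^ n)⁻¹ / P * ((1 + (e ^ 2)⁻¹) * y * S1) := by
    intro y
    rw [pow_succ, pow_succ]; field_simp
  have g3 : (1 - (a : ℂ) * z) = 1 - a * (z * e ^ 2) * (e ^ 2)⁻¹ := by field_simp
  have g4 : (1 - (a : ℂ) * (z * e ^ 2)⁻¹) = 1 - a * z⁻¹ * (e ^ 2)⁻¹ := by
    rw [mul_inv, mul_assoc]
  rw [g2, g1, g3, g4, mul_pow, mul_inv]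
  linear_combination (((a : ℂ) ^ n)⁻¹ * (e ^ n)⁻¹ / P) * K
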